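/- Let six distinct lines in Pic S₈ pairwise intersect in 1 (an A₅⁸(1)-polytope). Then there exist exactly three 4-element subsets forming cornered A₃⁸(1)-polytopes, and the six lines can be labeled l₁, …, l₆ so that these three cornered subsets are {l₁, l₂, l₃, l₄}, {l₁, l₂, l₅, l₆} and {l₃, l₄, l₅, l₆}. -/

import Mathlib

/-!
Picard lattice of the degree 1 del Pezzo surface S₈:
Pic S₈ = ℤh ⊕ ℤe₁ ⊕ ⋯ ⊕ ℤe₈ ≅ ℤ⁹, with intersection pairing
h·h = 1, h·eᵢ = 0, eᵢ·eⱼ = −δᵢⱼ, and canonical class K = −3h + e₁ + ⋯ + e₈.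
-/

namespace DelPezzo

/-- The Picard lattice `Pic S₈ ≅ ℤ⁹`; coordinate `0` is the `h`-coordinate and
coordinates `1,…,8` are the `e₁,…,e₈`-coordinates. -/
abbrev Pic : Type := Fin 9 → ℤ

/-- The intersection pairing on `Pic S₈` (signature `(1,-8)`). -/
def inter (x y : Pic) : ℤ := x 0 * y 0 - ∑ i : Fin 8, x i.succ * y i.succ

/-- The canonical class `K = -3h + e₁ + ⋯ + e₈`. -/
def K : Pic := fun i => if i = 0 then -3 else 1

/-- A line: a class `l` with `l·l = -1` and `l·K = -1`. -/
def IsLine (l : Pic) : Prop := inter l l = -1 ∧ inter l K = -1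

/-- A finite set of lines is cornered if some line has intersection `0` with all of them. -/
def IsCornered (T : Finset Pic) : Prop := ∃ m : Pic, IsLine m ∧ ∀ x ∈ T, inter m x = 0

theorem inter_comm (x y : Pic) : inter x y = inter y x := by
  simp only [inter, mul_comm]

/-- The intersection pairing as a bilinear form. -/
def interForm : LinearMap.BilinForm ℤ Pic :=
  LinearMap.mk₂ ℤ inter
    (fun x y z => by simp [inter, add_mul, Finset.sum_add_distrib]; ring)
    (fun c x y => by simp [inter, mul_sub, Finset.mul_sum, mul_assoc])
    (fun x y z => by simp [inter, mul_add, Finset.sum_add_distrib]; ring)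
    (fun c x y => by simp [inter, mul_sub, Finset.mul_sum, mul_left_comm])

theorem inter_add_left (x y z : Pic) : inter (x + y) z = inter x z + inter y z :=
  interForm.map_add₂ x y z

theorem inter_add_right (x y z : Pic) : inter x (y + z) = inter x y + inter x z :=
  (interForm x).map_add y z

theorem inter_sub_left (x y z : Pic) : inter (x - y) z = inter x z - inter y z :=
  interForm.map_sub₂ x y z

theorem inter_sub_right (x y z : Pic) : inter x (y - z) = inter x y - inter x z :=
  (interForm x).map_sub y z

theorem inter_sum_left {ι : Type*} (s : Finset ι) (f : ι → Pic) (y : Pic) :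
    inter (∑ i ∈ s, f i) y = ∑ i ∈ s, inter (f i) y :=
  interForm.map_sum₂ s f y

theorem inter_sum_right {ι : Type*} (s : Finset ι) (f : ι → Pic) (y : Pic) :
    inter y (∑ i ∈ s, f i) = ∑ i ∈ s, inter y (f i) :=
  map_sum (interForm y) f s

theorem inter_K_K : inter K K = 1 := by decide

/-- The canonical class is a characteristic vector of the Picard lattice. -/
theorem even_inter_self_sub_inter_K (x : Pic) : Even (inter x x - inter x K) := by
  have h : inter x x - inter x K =
      x 0 * (x 0 + 1) + 2 * x 0 - ∑ i : Fin 8, x i.succ * (x i.succ - 1) := by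
    simp [inter, K, mul_sub, Finset.sum_sub_distrib, Fin.succ_ne_zero]
    ring
  rw [h]
  exact ((Int.even_mul_succ_self _).add (even_two_mul _)).sub
    (Finset.even_sum _ fun i _ => Int.even_mul_pred_self _)

/-- The intersection pairing is anisotropic on the orthogonal complement of `K`. -/
theorem eq_zero_of_inter_self_eq_zero {x : Pic} (hK : inter x K = 0) (hx : inter x x = 0) :
    x = 0 := by
  have h1 : ∑ i : Fin 8, x i.succ = -3 * x 0 := by
    simp [inter, K, Fin.succ_ne_zero] at hK
    linarith
  have h2 : ∑ i : Fin 8, x i.succ ^ 2 = x 0 ^ 2 := by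
    simp only [inter, ← sq] at hx
    linarith
  have h3 := sq_sum_le_card_mul_sum_sq (s := Finset.univ) (f := fun i : Fin 8 => x i.succ)
  rw [h1, h2] at h3
  simp only [Finset.card_univ, Fintype.card_fin, Nat.cast_ofNat] at h3
  have h0 : x 0 = 0 := pow_eq_zero_iff two_ne_zero |>.1 (by nlinarith [sq_nonneg (x 0)])
  rw [h0, zero_pow two_ne_zero, Finset.sum_eq_zero_iff_of_nonneg fun i _ => sq_nonneg _] at h2
  funext j
  refine Fin.cases h0 (fun i => ?_) j
  exact pow_eq_zero_iff two_ne_zero |>.1 (h2 i (Finset.mem_univ i))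

theorem IsLine.inter_add_K_K {x : Pic} (hx : IsLine x) : inter (x + K) K = 0 := by
  rw [inter_add_left, hx.2, inter_K_K]; rfl

theorem IsLine.inter_add_K_add_K {x y : Pic} (hx : IsLine x) (hy : IsLine y) :
    inter (x + K) (y + K) = inter x y - 1 := by
  rw [inter_add_right, hx.inter_add_K_K, inter_add_left, inter_comm K, hy.2]; ring

theorem even_iff_forall_intCast_eq_zero (v : Pic) : Even v ↔ ∀ k, (v k : ZMod 2) = 0 := by
  simp only [ZMod.intCast_zmod_eq_zero_iff_dvd, Nat.cast_ofNat, ← even_iff_two_dvd]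
  constructor
  · rintro ⟨m, rfl⟩ k
    exact ⟨m k, rfl⟩
  · intro h
    choose m hm using h
    exact ⟨m, funext hm⟩

theorem intCast_inter (x y : Pic) :
    (inter x y : ZMod 2) = ∑ k, (x k : ZMod 2) * (y k : ZMod 2) := by
  simp [inter, Fin.sum_univ_succ (n := 8), CharTwo.sub_eq_add]

/-- Six vectors with even pairwise intersections satisfy two independent relations mod 2. -/
theorem exists_even_sums {ι : Type*} [Fintype ι] (hι : 6 ≤ Fintype.card ι) (r : ι → Pic)
    (hr : ∀ i j, Even (inter (r i) (r j))) :
    ∃ A B : Finset ι, A.Nonempty ∧ B.Nonempty ∧ A ≠ B ∧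
      Even (∑ i ∈ A, r i) ∧ Even (∑ i ∈ B, r i) := by
  classical
  let M : Matrix (Fin 9) ι (ZMod 2) := .of fun k i => (r i k : ZMod 2)
  have hM : M.transpose * M = 0 := by
    ext i j
    have h := (hr i j).two_dvd
    rw [← Nat.cast_ofNat, ← ZMod.intCast_zmod_eq_zero_iff_dvd, intCast_inter] at h
    simpa [Matrix.mul_apply, M] using h
  have hrank := Matrix.rank_add_rank_le_card_of_mul_eq_zero hM
  rw [Matrix.rank_transpose, Fintype.card_fin] at hrank
  have hker := M.mulVecLin.finrank_range_add_finrank_ker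
  rw [Module.finrank_fintype_fun_eq_card] at hker
  change M.rank + _ = _ at hker
  have hcard := Module.card_eq_pow_finrank (K := ZMod 2) (V := M.mulVecLin.ker)
  rw [ZMod.card] at hcard
  have h4 : 2 ^ 2 ≤ Fintype.card M.mulVecLin.ker :=
    hcard ▸ Nat.pow_le_pow_right two_pos (by omega)
  obtain ⟨a, b, c, hab, hac, hbc⟩ :=
    Fintype.two_lt_card_iff.1 (show 2 < Fintype.card M.mulVecLin.ker by omega)
  let supp (v : ι → ZMod 2) : Finset ι := {i | v i ≠ 0}
  have hval : ∀ z : ZMod 2, z = if z ≠ 0 then 1 else 0 := by decide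
  have hinj : Function.Injective supp := fun v w h => by
    funext i
    have := Finset.ext_iff.1 h i
    simp only [supp, Finset.mem_filter, Finset.mem_univ, true_and] at this
    rw [hval (v i), hval (w i)]
    simp only [this]
  have hne (v : M.mulVecLin.ker) (hv : v ≠ 0) : (supp v).Nonempty := by
    by_contra h
    exact hv (Subtype.ext (hinj ((Finset.not_nonempty_iff_eq_empty.1 h).trans (by simp [supp]))))
  have heven (v : M.mulVecLin.ker) : Even (∑ i ∈ supp v, r i) := by
    rw [even_iff_forall_intCast_eq_zero]
    intro k
    have hk : ∑ i, M k i * v.1 i = 0 := congrFun (LinearMap.mem_ker.1 v.2) k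
    rw [Finset.sum_apply, Int.cast_sum, Finset.sum_filter]
    refine Eq.trans ?_ hk
    refine Finset.sum_congr rfl fun i _ => ?_
    conv_rhs => rw [hval (v.1 i)]
    simp [M]
  exact ⟨supp (a - b : M.mulVecLin.ker), supp (a - c : M.mulVecLin.ker),
    hne _ (sub_ne_zero.2 hab), hne _ (sub_ne_zero.2 hac),
    fun h => hbc (sub_right_injective (Subtype.ext (hinj h))), heven _, heven _⟩

theorem even_sum_symmDiff {ι : Type*} [DecidableEq ι] {A B : Finset ι} {r : ι → Pic}
    (hA : Even (∑ i ∈ A, r i)) (hB : Even (∑ i ∈ B, r i)) :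
    Even (∑ i ∈ symmDiff A B, r i) := by
  have h1 := Finset.sum_union_inter (s₁ := A) (s₂ := B) (f := r)
  have h2 := Finset.sum_sdiff (f := r)
    (Finset.inter_subset_union : A ∩ B ⊆ A ∪ B)
  rw [← Finset.sup_eq_union, ← Finset.inf_eq_inter, ← symmDiff_eq_sup_sdiff_inf,
    Finset.sup_eq_union, Finset.inf_eq_inter] at h2
  rw [show ∑ i ∈ symmDiff A B, r i = ∑ i ∈ A, r i + ∑ i ∈ B, r i -
    (∑ i ∈ A ∩ B, r i + ∑ i ∈ A ∩ B, r i) by rw [← h1, ← h2]; abel]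
  exact (hA.add hB).sub ⟨_, rfl⟩


theorem inter_sum_add_K {T : Finset Pic} (hline : ∀ x ∈ T, IsLine x)
    (hint : ∀ x ∈ T, ∀ y ∈ T, x ≠ y → inter x y = 1) {y : Pic} (hy : y ∈ T) :
    inter (∑ x ∈ T, (x + K)) (y + K) = -2 := by
  rw [inter_sum_left, Finset.sum_eq_single_of_mem y hy,
    (hline y hy).inter_add_K_add_K (hline y hy), (hline y hy).1]
  · rfl
  · intro x hx hxy
    rw [(hline x hx).inter_add_K_add_K (hline y hy), hint x hx y hy hxy]; rfl

theorem inter_sum_add_K_self {T : Finset Pic} (hline : ∀ x ∈ T, IsLine x)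
    (hint : ∀ x ∈ T, ∀ y ∈ T, x ≠ y → inter x y = 1) :
    inter (∑ x ∈ T, (x + K)) (∑ x ∈ T, (x + K)) = -2 * T.card := by
  rw [inter_sum_right, Finset.sum_congr rfl fun y hy => inter_sum_add_K hline hint hy,
    Finset.sum_const, nsmul_eq_mul, mul_comm]

theorem inter_sum_add_K_K {T : Finset Pic} (hline : ∀ x ∈ T, IsLine x) :
    inter (∑ x ∈ T, (x + K)) K = 0 := by
  rw [inter_sum_left]
  exact Finset.sum_eq_zero fun x hx => (hline x hx).inter_add_K_K

theorem four_dvd_card_of_even_sum {T : Finset Pic} (hline : ∀ x ∈ T, IsLine x)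
    (hint : ∀ x ∈ T, ∀ y ∈ T, x ≠ y → inter x y = 1) (hT : Even (∑ x ∈ T, (x + K))) :
    4 ∣ T.card := by
  obtain ⟨m, hm⟩ := hT
  have h1 := inter_sum_add_K_self hline hint
  have h2 := inter_sum_add_K_K hline
  simp only [hm, inter_add_left, inter_add_right] at h1 h2
  obtain ⟨k, hk⟩ := even_inter_self_sub_inter_K m
  omega

theorem isCornered_iff_even_sum {T : Finset Pic} (hline : ∀ x ∈ T, IsLine x)
    (hint : ∀ x ∈ T, ∀ y ∈ T, x ≠ y → inter x y = 1) (hT : T.card = 4) :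
    IsCornered T ↔ Even (∑ x ∈ T, (x + K)) := by
  have h1 := inter_sum_add_K_self hline hint
  have h2 := inter_sum_add_K_K hline
  rw [hT] at h1
  constructor
  · rintro ⟨m, hm, hmT⟩
    have h3 : inter (m + K) (∑ x ∈ T, (x + K)) = -4 := by
      rw [inter_sum_right, Finset.sum_congr rfl fun x hx =>
        (hm.inter_add_K_add_K (hline x hx)).trans (by rw [hmT x hx])]
      simp [hT]
    have h4 := hm.inter_add_K_add_K hm
    rw [hm.1] at h4
    have h5 := hm.inter_add_K_K
    refine ⟨m + K, ?_⟩
    rw [← sub_eq_zero]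
    generalize m + K = n at *
    generalize ∑ x ∈ T, (x + K) = s at *
    have h6 := inter_comm s n
    apply eq_zero_of_inter_self_eq_zero <;>
      simp only [inter_sub_left, inter_sub_right, inter_add_left, inter_add_right] <;> omega
  · rintro ⟨m, hm⟩
    have h3 := fun y hy => inter_sum_add_K (y := y) hline hint hy
    simp only [hm, inter_add_left, inter_add_right] at h1 h2 h3
    have h4 := inter_K_K
    have h5 := inter_comm K m
    have h6 : inter m K = 0 := by omega
    refine ⟨m - K, ⟨?_, ?_⟩, fun x hx => ?_⟩
    · simp only [inter_sub_left, inter_sub_right]; omega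
    · simp only [inter_sub_left]; omega
    · have h7 := h3 x hx
      have h8 := (hline x hx).2
      have h9 := inter_comm K x
      simp only [inter_sub_left]; omega

/-- Two distinct `4`-subsets of a `6`-set whose symmetric difference has `4` elements are unions
of two blocks in a common partition of the `6`-set into three pairs. -/
theorem exists_labeling {α : Type*} [DecidableEq α] {S A B : Finset α} (hS : S.card = 6)
    (hAS : A ⊆ S) (hBS : B ⊆ S) (hA : A.card = 4) (hB : B.card = 4)
    (hAB : (symmDiff A B).card = 4) :
    ∃ l : Fin 6 → α, Function.Injective l ∧ Finset.image l Finset.univ = S ∧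
      A = {l 0, l 1, l 2, l 3} ∧ B = {l 0, l 1, l 4, l 5} := by
  have h1 := Finset.card_sdiff_add_card_inter A B
  have h2 := Finset.card_sdiff_add_card_inter B A
  have h3 : (symmDiff A B).card = (A \ B).card + (B \ A).card :=
    Finset.card_union_of_disjoint disjoint_sdiff_sdiff
  rw [Finset.inter_comm B A] at h2
  obtain ⟨a, b, hab, h⟩ := Finset.card_eq_two.1 (show (A ∩ B).card = 2 by omega)
  obtain ⟨c, d, hcd, h'⟩ := Finset.card_eq_two.1 (show (A \ B).card = 2 by omega)
  obtain ⟨e, f, hef, h''⟩ := Finset.card_eq_two.1 (show (B \ A).card = 2 by omega)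
  have hA' : A = {a, b, c, d} := by
    rw [← Finset.sdiff_union_inter A B, h, h']; ext; simp; tauto
  have hB' : B = {a, b, e, f} := by
    rw [← Finset.sdiff_union_inter B A, Finset.inter_comm, h, h'']; ext; simp; tauto
  have hinj : Function.Injective ![a, b, c, d, e, f] := by
    have ha : a ∈ A ∩ B := by simp [h]
    have hb : b ∈ A ∩ B := by simp [h]
    have hc : c ∈ A \ B := by simp [h']
    have hd : d ∈ A \ B := by simp [h']
    have he : e ∈ B \ A := by simp [h'']
    have hf : f ∈ B \ A := by simp [h'']
    simp only [Finset.mem_inter, Finset.mem_sdiff] at ha hb hc hd he hf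
    rw [← List.nodup_ofFn]
    simp [List.ofFn_succ]
    grind
  refine ⟨![a, b, c, d, e, f], hinj, ?_, hA', hB'⟩
  refine Finset.eq_of_subset_of_card_le (fun x hx => ?_) ?_
  · obtain ⟨i, -, rfl⟩ := Finset.mem_image.1 hx
    fin_cases i
    · exact hAS (by simp [hA'])
    · exact hAS (by simp [hA'])
    · exact hAS (by simp [hA'])
    · exact hAS (by simp [hA'])
    · exact hBS (by simp [hB'])
    · exact hBS (by simp [hB'])
  · rw [Finset.card_image_of_injective _ hinj, hS]; rfl

theorem three_cornered_subsets_of_six (S : Finset Pic) (hcard : S.card = 6)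
    (hline : ∀ x ∈ S, IsLine x)
    (hint : ∀ x ∈ S, ∀ y ∈ S, x ≠ y → inter x y = 1) :
    ∃ l : Fin 6 → Pic, Function.Injective l ∧ Finset.image l Finset.univ = S ∧
      ∀ T : Finset Pic, T ⊆ S → T.card = 4 →
        (IsCornered T ↔
          T = {l 0, l 1, l 2, l 3} ∨ T = {l 0, l 1, l 4, l 5} ∨
          T = {l 2, l 3, l 4, l 5}) := by
  have hsub {T : Finset Pic} (hT : T ⊆ S) : (∀ x ∈ T, IsLine x) ∧
      ∀ x ∈ T, ∀ y ∈ T, x ≠ y → inter x y = 1 :=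
    ⟨fun x hx => hline x (hT hx), fun x hx y hy => hint x (hT hx) y (hT hy)⟩
  have hcard4 {T : Finset Pic} (hT : T ⊆ S) (hne : T.Nonempty)
      (heven : Even (∑ x ∈ T, (x + K))) : T.card = 4 := by
    have h1 := four_dvd_card_of_even_sum (hsub hT).1 (hsub hT).2 heven
    have h2 := Finset.card_le_card hT
    have h3 := hne.card_pos
    omega
  have hdiff {T U : Finset Pic} (hT : T ⊆ S) (hU : U ⊆ S) : symmDiff T U ⊆ S :=
    symmDiff_le_sup.trans (Finset.union_subset hT hU)
  have hr (i j : S) : Even (inter (i.1 + K) (j.1 + K)) := by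
    rw [(hline i i.2).inter_add_K_add_K (hline j j.2)]
    by_cases hij : i.1 = j.1
    · rw [hij, (hline j j.2).1]; decide
    · rw [hint i i.2 j j.2 hij]; decide
  obtain ⟨A', B', hA', hB', hAB', hAe', hBe'⟩ :=
    exists_even_sums (by simp [hcard]) (fun i : S => i.1 + K) hr
  obtain ⟨A, hAS, hAn, hAe, B, hBS, hBn, hBe, hAB⟩ : ∃ A ⊆ S, A.Nonempty ∧
      Even (∑ x ∈ A, (x + K)) ∧ ∃ B ⊆ S, B.Nonempty ∧ Even (∑ x ∈ B, (x + K)) ∧ A ≠ B :=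
    ⟨A'.map (.subtype _), Finset.map_subtype_subset A', hA'.map, by simpa using hAe',
      B'.map (.subtype _), Finset.map_subtype_subset B', hB'.map, by simpa using hBe',
      fun h => hAB' (Finset.map_injective _ h)⟩
  have hD := hcard4 (hdiff hAS hBS) (Finset.symmDiff_nonempty.2 hAB) (even_sum_symmDiff hAe hBe)
  obtain ⟨l, hl, hlS, hA, hB⟩ :=
    exists_labeling hcard hAS hBS (hcard4 hAS hAn hAe) (hcard4 hBS hBn hBe) hD
  have himg4 (i j k m : Fin 6) :
      ({l i, l j, l k, l m} : Finset Pic) = ({i, j, k, m} : Finset (Fin 6)).image l := by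
    simp [Finset.image_insert]
  rw [himg4] at hA hB
  have hC : symmDiff A B = ({2, 3, 4, 5} : Finset (Fin 6)).image l := by
    rw [hA, hB, ← Finset.image_symmDiff _ _ hl]; rfl
  have hCe := even_sum_symmDiff hAe hBe
  refine ⟨l, hl, hlS, fun T hTS hT => ?_⟩
  rw [isCornered_iff_even_sum (hsub hTS).1 (hsub hTS).2 hT]
  simp only [himg4, ← hA, ← hB, ← hC]
  refine ⟨fun hTe => ?_, ?_⟩
  · have hor {U : Finset Pic} (hU : U ⊆ S) (hUe : Even (∑ x ∈ U, (x + K))) :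
        T = U ∨ (symmDiff T U).card = 4 :=
      or_iff_not_imp_left.2 fun h =>
        hcard4 (hdiff hTS hU) (Finset.symmDiff_nonempty.2 h) (even_sum_symmDiff hTe hUe)
    have h1 := hor hAS hAe
    have h2 := hor hBS hBe
    have h3 := hor (hdiff hAS hBS) hCe
    rw [hC] at h3 ⊢
    rw [hA] at h1 ⊢
    rw [hB] at h2 ⊢
    rw [← hlS] at hTS
    obtain ⟨T, -, rfl⟩ := Finset.subset_image_iff.1 hTS
    simp only [← Finset.image_symmDiff _ _ hl, Finset.card_image_of_injective _ hl,
      (Finset.image_injective hl).eq_iff] at hT h1 h2 h3 ⊢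
    clear * - hT h1 h2 h3
    revert T
    decide
  · rintro (rfl | rfl | rfl)
    exacts [hAe, hBe, hCe]

end DelPezzo
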